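/- Let (g,⟨·,·⟩) be a unimodular metric Lie algebra with dim g = 4 and let X ∈ g be a stable stationary point of the Euler equation. Then rank J_X ≤ 2 and σ₂(J_X) ≥ 0. -/

import Mathlib

open scoped InnerProductSpace

/-- A Lie algebra structure (a bilinear Lie bracket) on the real inner product space `g`,
making `(g, ⟨·,·⟩)` a metric Lie algebra. -/
structure LieStructure (g : Type*) [NormedAddCommGroup g] [InnerProductSpace ℝ g] where
  bracket : g →ₗ[ℝ] g →ₗ[ℝ] g
  bracket_self : ∀ x, bracket x x = 0
  jacobi : ∀ x y z, bracket x (bracket y z) + bracket y (bracket z x) + bracket z (bracket x y) = 0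

namespace LieStructure

variable {g : Type*} [NormedAddCommGroup g] [InnerProductSpace ℝ g] [FiniteDimensional ℝ g]
variable (L : LieStructure g)

/-- `ad_Y : Z ↦ [Y, Z]`. -/
def ad (Y : g) : g →ₗ[ℝ] g := L.bracket Y

/-- `ad_Yᵗ`, the adjoint of `ad_Y` with respect to the inner product. -/
noncomputable def adT (Y : g) : g →ₗ[ℝ] g := LinearMap.adjoint (L.ad Y)

/-- A solution of the Euler equation `Ẏ = ad_Yᵗ Y`. -/
def IsSolution (Y : ℝ → g) : Prop := ∀ t : ℝ, HasDerivAt Y (L.adT (Y t) (Y t)) t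

/-- A stationary point (equilibrium) of the Euler equation: `ad_Xᵗ X = 0`. -/
def IsStationary (X : g) : Prop := L.adT X X = 0

/-- Lyapunov stability of a point `X` for the Euler equation: every solution starting
close to `X` remains close to `X` for all `t ≥ 0`. -/
def IsStable (X : g) : Prop :=
  ∀ ε > 0, ∃ δ > 0, ∀ Y : ℝ → g, L.IsSolution Y → ‖Y 0 - X‖ < δ → ∀ t ≥ 0, ‖Y t - X‖ < ε

/-- The linearisation `J_X : Y ↦ ad_Xᵗ Y + ad_Yᵗ X` of the Euler equation at `X`. -/
noncomputable def J (X : g) : g →ₗ[ℝ] g where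
  toFun Y := L.adT X Y + L.adT Y X
  map_add' Y Z := by
    simp only [adT, ad, map_add, LinearMap.add_apply]
    abel
  map_smul' c Y := by
    simp only [adT, ad, map_smul, map_smulₛₗ, starRingEnd_apply, star_trivial,
      LinearMap.smul_apply, RingHom.id_apply, smul_add]

/-- `g` is unimodular: `Tr (ad_X) = 0` for all `X`. -/
def IsUnimodular : Prop := ∀ X : g, LinearMap.trace ℝ g (L.ad X) = 0

/-- The centre of `g`: the set of `X` with `[X, ·] = 0`. -/
def center : Submodule ℝ g := LinearMap.ker L.bracket

end LieStructure

/-- `σ_k(J)`: the `k`-th elementary symmetric function of the eigenvalues of `J`, i.e.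
`(-1)^k` times the coefficient of `λ^(n-k)` in the characteristic polynomial
`det (λ·id - J)` of `J`, where `n = dim g`. -/
noncomputable def sigmaCoeff {g : Type*} [NormedAddCommGroup g] [InnerProductSpace ℝ g]
    [FiniteDimensional ℝ g] (k : ℕ) (J : g →ₗ[ℝ] g) : ℝ :=
  (-1 : ℝ) ^ k * (LinearMap.charpoly J).coeff (Module.finrank ℝ g - k)

/-- A bounded, globally Lipschitz autonomous vector field on a Banach space is complete. -/
theorem exists_global_solution_of_bounded_lipschitz {E : Type*} [NormedAddCommGroup E]
    [NormedSpace ℝ E] [CompleteSpace E] {v : E → E} {K M : NNReal} (hv : LipschitzWith K v)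
    (hM : ∀ x, ‖v x‖ ≤ M) (x₀ : E) :
    ∃ y : ℝ → E, y 0 = x₀ ∧ ∀ t, HasDerivAt y (v (y t)) t := by
  have key : ∀ T : ℝ, ∃ y : ℝ → E, 0 < T →
      y 0 = x₀ ∧ ∀ t ∈ Set.Ioo (-T) T, HasDerivAt y (v (y t)) t := by
    intro T
    by_cases hT : 0 < T
    · have hpl : IsPicardLindelof (fun _ : ℝ => v) (tmin := -T) (tmax := T)
          ⟨0, by constructor <;> linarith⟩ x₀ (M * ⟨T, hT.le⟩) 0 M K :=
        { lipschitzOnWith := fun _ _ => hv.lipschitzOnWith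
          continuousOn := fun _ _ => continuousOn_const
          norm_le := fun _ _ x _ => hM x
          mul_max_le := by simp; rfl }
      obtain ⟨y, hy0, hy⟩ := hpl.exists_eq_forall_mem_Icc_hasDerivWithinAt₀
      exact ⟨y, fun _ => ⟨hy0, fun t ht =>
        (hy t (Set.Ioo_subset_Icc_self ht)).hasDerivAt (Icc_mem_nhds ht.1 ht.2)⟩⟩
    · exact ⟨fun _ => x₀, fun h => absurd h hT⟩
  choose y hy using key
  have heq : ∀ a b, 0 < a → a ≤ b → Set.EqOn (y a) (y b) (Set.Ioo (-a) a) := by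
    intro a b ha hab
    have hsub : Set.Ioo (-a) a ⊆ Set.Ioo (-b) b := Set.Ioo_subset_Ioo (by linarith) hab
    exact ODE_solution_unique_of_mem_Ioo (v := fun _ => v) (s := fun _ => Set.univ) (K := K)
      (t₀ := 0) (fun _ _ => hv.lipschitzOnWith) ⟨by linarith, ha⟩
      (fun t ht => ⟨(hy a ha).2 t ht, trivial⟩)
      (fun t ht => ⟨(hy b (by linarith)).2 t (hsub ht), trivial⟩)
      (by rw [(hy a ha).1, (hy b (by linarith)).1])
  refine ⟨fun t => y (|t| + 1) t, by simpa using (hy 1 one_pos).1, fun t => ?_⟩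
  have hpos : 0 < |t| + 1 := by positivity
  have ht : t ∈ Set.Ioo (-(|t| + 1)) (|t| + 1) := by
    rw [Set.mem_Ioo, ← abs_lt]; linarith
  refine ((hy _ hpos).2 t ht).congr_of_eventuallyEq ?_
  filter_upwards [Ioo_mem_nhds ht.1 ht.2] with s hs
  have hs' : s ∈ Set.Ioo (-(|s| + 1)) (|s| + 1) := by
    rw [Set.mem_Ioo, ← abs_lt]; linarith
  rcases le_total (|s| + 1) (|t| + 1) with h | h
  · exact heq _ _ (by positivity) h hs'
  · exact (heq _ _ hpos h hs).symm

/-- A smooth vector field on a finite-dimensional inner product space which is orthogonal to the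
position vector is complete. -/
theorem exists_global_solution_of_inner_self_eq_zero {E : Type*} [NormedAddCommGroup E]
    [InnerProductSpace ℝ E] [FiniteDimensional ℝ E] {v : E → E} (hv : ContDiff ℝ 1 v)
    (horth : ∀ x, ⟪x, v x⟫_ℝ = 0) (x₀ : E) :
    ∃ y : ℝ → E, y 0 = x₀ ∧ ∀ t, HasDerivAt y (v (y t)) t := by
  let χ : ContDiffBump (0 : E) := ⟨‖x₀‖ + 1, ‖x₀‖ + 2, by positivity, by linarith⟩
  have hsm : ContDiff ℝ 1 (fun x => χ x • v x) := χ.contDiff.smul hv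
  have hsupp : HasCompactSupport (fun x => χ x • v x) := χ.hasCompactSupport.smul_right
  obtain ⟨K, hK⟩ := hsm.lipschitzWith_of_hasCompactSupport hsupp one_ne_zero
  obtain ⟨M, hM⟩ := hsupp.exists_bound_of_continuous hsm.continuous
  obtain ⟨y, hy0, hy⟩ := exists_global_solution_of_bounded_lipschitz hK (M := M.toNNReal)
    (fun x => (hM x).trans (Real.le_coe_toNNReal M)) x₀
  have hder : ∀ t, HasDerivAt (fun t => ⟪y t, y t⟫_ℝ) 0 t := fun t => by
    simpa [inner_smul_left, inner_smul_right, horth, real_inner_comm] using (hy t).inner ℝ (hy t)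
  have hnorm : ∀ t, ‖y t‖ = ‖x₀‖ := fun t => by
    have h := is_const_of_deriv_eq_zero (fun t => (hder t).differentiableAt)
      (fun t => (hder t).deriv) t 0
    simp only [real_inner_self_eq_norm_sq, hy0] at h
    exact (sq_eq_sq₀ (norm_nonneg _) (norm_nonneg _)).mp h
  refine ⟨y, hy0, fun t => ?_⟩
  have hχ : χ (y t) = 1 := χ.one_of_mem_closedBall (by
    simp only [mem_closedBall_zero_iff, hnorm t, χ]; linarith)
  simpa [hχ] using hy t

/-- A differentiable function on `[0, ∞)` satisfying `f' ≥ μ f` with `μ > 0` and `f 0 > 0` is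
unbounded. -/
theorem not_bounded_of_deriv_ge_mul {f f' : ℝ → ℝ} {μ B : ℝ} (hμ : 0 < μ)
    (hf : ∀ t, HasDerivAt f (f' t) t) (hf' : ∀ t ≥ 0, μ * f t ≤ f' t) (h0 : 0 < f 0)
    (hB : ∀ t ≥ 0, f t ≤ B) : False := by
  have hd : ∀ t, HasDerivAt (fun t => f t * Real.exp (-(μ * t)))
      (f' t * Real.exp (-(μ * t)) + f t * (Real.exp (-(μ * t)) * -μ)) t := fun t =>
    (hf t).mul (((hasDerivAt_id t).const_mul μ).neg.exp.congr_deriv (by simp))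
  have hmono : MonotoneOn (fun t => f t * Real.exp (-(μ * t))) (Set.Ici 0) := by
    refine monotoneOn_of_deriv_nonneg (convex_Ici 0)
      (fun t _ => (hd t).continuousAt.continuousWithinAt)
      (fun t _ => (hd t).differentiableAt.differentiableWithinAt) fun t ht => ?_
    rw [interior_Ici] at ht
    rw [(hd t).deriv]
    have := mul_nonneg (sub_nonneg.mpr (hf' t (le_of_lt ht))) (Real.exp_pos (-(μ * t))).le
    linarith
  have hlow : ∀ t ≥ 0, f 0 * (μ * t) ≤ B := fun t ht => by
    have h1 : f 0 ≤ f t * Real.exp (-(μ * t)) := by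
      simpa using hmono (Set.self_mem_Ici) ht ht
    have h2 : f 0 * Real.exp (μ * t) ≤ f t := by
      have := mul_le_mul_of_nonneg_right h1 (Real.exp_pos (μ * t)).le
      rwa [mul_assoc, ← Real.exp_add, neg_add_cancel, Real.exp_zero, mul_one] at this
    have h3 : f 0 * (μ * t) ≤ f 0 * Real.exp (μ * t) :=
      mul_le_mul_of_nonneg_left (by linarith [Real.add_one_le_exp (μ * t)]) h0.le
    exact (h3.trans h2).trans (hB t ht)
  have hB0 : 0 < B := h0.trans_le (hB 0 le_rfl)
  have := hlow ((B + 1) / (f 0 * μ)) (by positivity)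
  rw [← mul_assoc, mul_div_cancel₀ _ (by positivity)] at this
  linarith

namespace LieStructure

variable {g : Type*} [NormedAddCommGroup g] [InnerProductSpace ℝ g] (L : LieStructure g)

theorem bracket_antisymm (x y : g) : L.bracket x y = -L.bracket y x := by
  have h := L.bracket_self (x + y)
  simp only [map_add, LinearMap.add_apply, L.bracket_self, zero_add, add_zero] at h
  exact eq_neg_of_add_eq_zero_right h

/-- `ad_x` is a derivation of the bracket. -/
theorem bracket_leibniz (x y z : g) :
    L.bracket x (L.bracket y z) = L.bracket (L.bracket x y) z + L.bracket y (L.bracket x z) := by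
  have h := L.jacobi x y z
  rw [L.bracket_antisymm z (L.bracket x y), L.bracket_antisymm z x, map_neg] at h
  rw [← sub_eq_zero, ← h]
  abel

variable [FiniteDimensional ℝ g]

theorem inner_adT (Y Z W : g) : ⟪L.adT Y Z, W⟫_ℝ = ⟪Z, L.bracket Y W⟫_ℝ :=
  LinearMap.adjoint_inner_left _ _ _

theorem inner_J (X Y W : g) :
    ⟪L.J X Y, W⟫_ℝ = ⟪Y, L.bracket X W⟫_ℝ + ⟪X, L.bracket Y W⟫_ℝ := by
  simp [J, inner_add_left, inner_adT]

/-- `ad_Yᵗ Z` as a bilinear map in `Y` and `Z`. -/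
noncomputable def adTBilin : g →ₗ[ℝ] g →ₗ[ℝ] g :=
  (LinearMap.adjoint (𝕜 := ℝ) (E := g) (F := g)).toLinearMap.comp L.bracket

theorem exists_isSolution (Y₀ : g) : ∃ Y : ℝ → g, L.IsSolution Y ∧ Y 0 = Y₀ := by
  have hv : ContDiff ℝ 1 (fun Y => L.adT Y Y) :=
    ContDiff.clm_apply (f := fun Y => L.adTBilin.toContinuousBilinearMap Y)
      (ContinuousLinearMap.contDiff _) contDiff_id
  obtain ⟨Y, h0, hY⟩ := exists_global_solution_of_inner_self_eq_zero hv
    (fun Y => by rw [real_inner_comm, inner_adT, L.bracket_self, inner_zero_right]) Y₀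
  exact ⟨Y, hY, h0⟩

theorem exists_norm_adT_self_le : ∃ C > 0, ∀ Y : g, ‖L.adT Y Y‖ ≤ C * ‖Y‖ ^ 2 := by
  refine ⟨‖L.adTBilin.toContinuousBilinearMap‖ + 1, by positivity, fun Y => ?_⟩
  have h := L.adTBilin.toContinuousBilinearMap.le_opNorm₂ Y Y
  have h' : ‖L.adT Y Y‖ ≤ ‖L.adTBilin.toContinuousBilinearMap‖ * ‖Y‖ * ‖Y‖ := h
  nlinarith [sq_nonneg ‖Y‖]

theorem adT_self_eq_of_isStationary {X : g} (hX : L.IsStationary X) (Y : g) :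
    L.adT Y Y = L.J X (Y - X) + L.adT (Y - X) (Y - X) := by
  have hX' : L.adTBilin X X = 0 := hX
  change L.adTBilin Y Y =
    L.adTBilin X (Y - X) + L.adTBilin (Y - X) X + L.adTBilin (Y - X) (Y - X)
  simp only [map_sub, LinearMap.sub_apply, hX']
  abel

/-- A stationary point at which the linearisation satisfies `J³ = μ² J` and has the positive
eigenvalue `μ` is unstable. -/
theorem not_isStable_of_J_pow_three {X : g} (hX : L.IsStationary X) {μ : ℝ} (hμ : 0 < μ)
    (hJ : L.J X ^ 3 = μ ^ 2 • L.J X) (hne : L.J X ^ 2 + μ • L.J X ≠ 0) : ¬ L.IsStable X := by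
  intro hst
  set A := L.J X with hA
  have hJ3 : ∀ y, A (A (A y)) = μ ^ 2 • A y := fun y => by
    simpa [pow_succ] using LinearMap.congr_fun hJ y
  let P : g →L[ℝ] g := LinearMap.toContinuousLinearMap (A ^ 2 + μ • A)
  let M : g →L[ℝ] g := LinearMap.toContinuousLinearMap (A ^ 2 - μ • A)
  let Z : g →L[ℝ] g := LinearMap.toContinuousLinearMap (A ^ 2 - μ ^ 2 • LinearMap.id)
  have hP : ∀ y, P y = A (A y) + μ • A y := fun y => by simp [P, pow_two]
  have hM : ∀ y, M y = A (A y) - μ • A y := fun y => by simp [M, pow_two]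
  have hZ : ∀ y, Z y = A (A y) - μ ^ 2 • y := fun y => by simp [Z, pow_two]
  have hPA : ∀ y, P (A y) = μ • P y := fun y => by rw [hP, hP, hJ3]; module
  have hMA : ∀ y, M (A y) = -μ • M y := fun y => by rw [hM, hM, hJ3]; module
  have hZA : ∀ y, Z (A y) = 0 := fun y => by rw [hZ, hJ3, sub_self]
  obtain ⟨C, hC, hF⟩ := L.exists_norm_adT_self_le
  set k : ℝ := ‖P‖ + ‖M‖ + ‖Z‖ + 1 with hk
  have hkpos : 0 < k := by positivity
  have bound : ∀ T : g →L[ℝ] g, ‖T‖ ≤ k → ∀ y z, |⟪T y, T z⟫_ℝ| ≤ k ^ 2 * (‖y‖ * ‖z‖) := by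
    intro T hT y z
    calc |⟪T y, T z⟫_ℝ| ≤ ‖T y‖ * ‖T z‖ := abs_real_inner_le_norm _ _
      _ ≤ (k * ‖y‖) * (k * ‖z‖) := by
          gcongr
          · exact (T.le_opNorm y).trans (by gcongr)
          · exact (T.le_opNorm z).trans (by gcongr)
      _ = k ^ 2 * (‖y‖ * ‖z‖) := by ring
  have hPk : ‖P‖ ≤ k := by linarith [norm_nonneg M, norm_nonneg Z]
  have hMk : ‖M‖ ≤ k := by linarith [norm_nonneg P, norm_nonneg Z]
  have hZk : ‖Z‖ ≤ k := by linarith [norm_nonneg M, norm_nonneg P]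
  have hdec : ∀ y, 4 * μ ^ 4 * ‖y‖ ^ 2 ≤ 6 * (‖P y‖ ^ 2 + ‖M y‖ ^ 2 + ‖Z y‖ ^ 2) := by
    intro y
    have h1 : (2 * μ ^ 2) • y = P y + M y - (2 : ℝ) • Z y := by
      rw [hP, hM, hZ]; module
    have h2 : 2 * μ ^ 2 * ‖y‖ ≤ ‖P y‖ + ‖M y‖ + 2 * ‖Z y‖ := by
      calc 2 * μ ^ 2 * ‖y‖ = ‖(2 * μ ^ 2) • y‖ := by
            rw [norm_smul, Real.norm_of_nonneg (by positivity)]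
        _ ≤ ‖P y‖ + ‖M y‖ + ‖(2 : ℝ) • Z y‖ := by
            rw [h1]
            exact (norm_sub_le _ _).trans (by gcongr; exact norm_add_le _ _)
        _ = _ := by rw [norm_smul]; norm_num
    have h3 := pow_le_pow_left₀ (by positivity) h2 2
    nlinarith [sq_nonneg (‖P y‖ - ‖M y‖), sq_nonneg (2 * ‖P y‖ - ‖Z y‖),
      sq_nonneg (2 * ‖M y‖ - ‖Z y‖)]
  set ε : ℝ := μ ^ 5 / (9 * k ^ 2 * C) with hε
  have hεpos : 0 < ε := by positivity
  obtain ⟨δ, hδ, hstab⟩ := hst ε hεpos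
  obtain ⟨w, hw⟩ : ∃ w, (A ^ 2 + μ • A) w ≠ 0 := by
    by_contra! h
    exact hne (LinearMap.ext h)
  have hPw : P w ≠ 0 := hw
  -- `u = P w` is an eigenvector for `μ`
  have hAu : A (P w) = μ • P w := by
    rw [hP]; simp only [map_add, map_smul, hJ3]; module
  set u := P w with hu
  have hupos : 0 < ‖u‖ := norm_pos_iff.mpr hPw
  set s : ℝ := δ / (2 * ‖u‖) with hs
  have hspos : 0 < s := by positivity
  obtain ⟨Y, hY, hY0⟩ := L.exists_isSolution (X + s • u)
  have hnear := hstab Y hY (by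
    rw [hY0, add_sub_cancel_left, norm_smul, Real.norm_of_nonneg hspos.le, hs]
    field_simp
    linarith)
  let y : ℝ → g := fun t => Y t - X
  have hy : ∀ t, HasDerivAt y (A (y t) + L.adT (y t) (y t)) t := fun t => by
    have h := (hY t).sub_const X
    rwa [L.adT_self_eq_of_isStationary hX] at h
  have hT : ∀ (T : g →L[ℝ] g) t, HasDerivAt (fun t => ‖T (y t)‖ ^ 2)
      (2 * ⟪T (y t), T (A (y t)) + T (L.adT (y t) (y t))⟫_ℝ) t := fun T t => by
    have h := (T.hasFDerivAt.comp_hasDerivAt t (hy t)).norm_sq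
    simpa using h
  have hQ := fun t => ((hT P t).sub (hT M t)).sub (hT Z t)
  refine not_bounded_of_deriv_ge_mul hμ hQ (B := (k * ε) ^ 2) ?_ ?_ ?_
  · intro t ht
    simp only [Pi.sub_apply]
    have hyt : ‖y t‖ ≤ ε := (hnear t ht).le
    have hcub : k ^ 2 * (‖y t‖ * ‖L.adT (y t) (y t)‖) ≤ k ^ 2 * C * ε * ‖y t‖ ^ 2 := by
      calc k ^ 2 * (‖y t‖ * ‖L.adT (y t) (y t)‖)
          ≤ k ^ 2 * (ε * (C * ‖y t‖ ^ 2)) := by gcongr; exact hF _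
        _ = _ := by ring
    have hsmall : 6 * (k ^ 2 * C * ε * ‖y t‖ ^ 2) ≤
        μ * (‖P (y t)‖ ^ 2 + ‖M (y t)‖ ^ 2 + ‖Z (y t)‖ ^ 2) := by
      have : k ^ 2 * C * ε = μ ^ 5 / 9 := by rw [hε]; field_simp
      rw [this]
      nlinarith [mul_le_mul_of_nonneg_left (hdec (y t)) hμ.le]
    have b1 := abs_le.mp (bound P hPk (y t) (L.adT (y t) (y t)))
    have b2 := abs_le.mp (bound M hMk (y t) (L.adT (y t) (y t)))
    have b3 := abs_le.mp (bound Z hZk (y t) (L.adT (y t) (y t)))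
    rw [hPA, hMA, hZA]
    simp only [inner_add_right, inner_smul_right, real_inner_self_eq_norm_sq, inner_zero_right]
    have hm := mul_nonneg hμ.le (sq_nonneg ‖M (y t)‖)
    linarith [b1.1, b2.2, b3.2]
  · have h0 : y 0 = s • u := by simp [y, hY0]
    have hPu : P u = (2 * μ ^ 2) • u := by
      rw [hP, hAu, map_smul, hAu]; module
    have hMu : M u = 0 := by rw [hM, hAu, map_smul, hAu]; module
    have hZu : Z u = 0 := by rw [hZ, hAu, map_smul, hAu]; module
    simp only [Pi.sub_apply, h0, map_smul, hPu, hMu, hZu, smul_zero, norm_zero]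
    have : 0 < ‖s • (2 * μ ^ 2) • u‖ := by
      rw [norm_smul, norm_smul, Real.norm_of_nonneg hspos.le,
        Real.norm_of_nonneg (by positivity)]
      positivity
    simpa using pow_pos this 2
  · intro t ht
    simp only [Pi.sub_apply]
    have h1 : ‖P (y t)‖ ≤ k * ε :=
      (P.le_opNorm _).trans (mul_le_mul hPk (hnear t ht).le (norm_nonneg _) hkpos.le)
    have h2 := pow_le_pow_left₀ (norm_nonneg _) h1 2
    linarith [sq_nonneg ‖M (y t)‖, sq_nonneg ‖Z (y t)‖]

/-- If `X^⊥` is abelian and `ad_X` has a complex eigenvalue of positive real part there, then `X` is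
unstable. -/
theorem not_isStable_of_abelian_orthogonal {X : g} (hX0 : X ≠ 0)
    (habel : ∀ u v, ⟪X, u⟫_ℝ = 0 → ⟪X, v⟫_ℝ = 0 → L.bracket u v = 0)
    {a b : g} (ha : ⟪X, a⟫_ℝ = 0) (hb : ⟪X, b⟫_ℝ = 0) (hab : a ≠ 0 ∨ b ≠ 0) {α β : ℝ} (hα : 0 < α)
    (hDa : L.bracket X a = α • a - β • b) (hDb : L.bracket X b = β • a + α • b) :
    ¬ L.IsStable X := by
  intro hst
  have hXpos : 0 < ‖X‖ := norm_pos_iff.mpr hX0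
  have hbr : ∀ Y v, ⟪X, v⟫_ℝ = 0 →
      L.bracket Y v = (⟪X, Y⟫_ℝ / ‖X‖ ^ 2) • L.bracket X v := by
    intro Y v hv
    have h := habel (Y - (⟪X, Y⟫_ℝ / ‖X‖ ^ 2) • X) v (by
      rw [inner_sub_right, inner_smul_right, real_inner_self_eq_norm_sq]
      field_simp
      ring) hv
    rwa [map_sub, map_smul, LinearMap.sub_apply, LinearMap.smul_apply, sub_eq_zero] at h
  obtain ⟨δ, hδ, hstab⟩ := hst (‖X‖ / 2) (by positivity)
  obtain ⟨c, hc, hc0, hcX⟩ : ∃ c, (c = a ∨ c = b) ∧ c ≠ 0 ∧ ⟪X, c⟫_ℝ = 0 := by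
    rcases hab with h | h
    · exact ⟨a, .inl rfl, h, ha⟩
    · exact ⟨b, .inr rfl, h, hb⟩
  have hcpos : 0 < ‖c‖ := norm_pos_iff.mpr hc0
  set s : ℝ := δ / (2 * ‖c‖) with hs
  have hspos : 0 < s := by positivity
  obtain ⟨Y, hY, hY0⟩ := L.exists_isSolution (X + s • c)
  have hnear := hstab Y hY (by
    rw [hY0, add_sub_cancel_left, norm_smul, Real.norm_of_nonneg hspos.le, hs]
    field_simp
    linarith)
  set x : ℝ → ℝ := fun t => ⟪X, Y t⟫_ℝ / ‖X‖ ^ 2 with hx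
  have hxlow : ∀ t ≥ 0, 1 / 2 ≤ x t := by
    intro t ht
    have h1 : |⟪X, Y t - X⟫_ℝ| ≤ ‖X‖ * (‖X‖ / 2) :=
      (abs_real_inner_le_norm _ _).trans (by gcongr; exact (hnear t ht).le)
    rw [inner_sub_right, real_inner_self_eq_norm_sq] at h1
    rw [hx, le_div_iff₀ (by positivity)]
    linarith [(abs_le.mp h1).1]
  have hd : ∀ v, ⟪X, v⟫_ℝ = 0 → ∀ t, HasDerivAt (fun t => ⟪Y t, v⟫_ℝ)
      (x t * ⟪Y t, L.bracket X v⟫_ℝ) t := by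
    intro v hv t
    have h := (hY t).inner ℝ (hasDerivAt_const t v)
    rwa [inner_zero_right, zero_add, inner_adT, hbr _ _ hv, inner_smul_right] at h
  have hQ := fun t => ((hd a ha t).pow 2).add ((hd b hb t).pow 2)
  refine not_bounded_of_deriv_ge_mul hα hQ
    (B := (2 * ‖X‖ * ‖a‖) ^ 2 + (2 * ‖X‖ * ‖b‖) ^ 2) ?_ ?_ ?_
  · intro t ht
    simp only [Pi.add_apply, Pi.pow_apply, hDa, hDb, inner_add_right, inner_sub_right,
      inner_smul_right]
    have h := mul_nonneg (mul_nonneg hα.le (sub_nonneg.mpr (hxlow t ht)))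
      (add_nonneg (sq_nonneg ⟪Y t, a⟫_ℝ) (sq_nonneg ⟪Y t, b⟫_ℝ))
    norm_num
    nlinarith
  · have hip : ∀ v, ⟪X, v⟫_ℝ = 0 → ⟪Y 0, v⟫_ℝ = s * ⟪c, v⟫_ℝ := fun v hv => by
      rw [hY0, inner_add_left, hv, inner_smul_left]; simp
    have hcc : 0 < (s * ⟪c, c⟫_ℝ) ^ 2 := by
      rw [real_inner_self_eq_norm_sq]; positivity
    simp only [Pi.add_apply, Pi.pow_apply, hip a ha, hip b hb]
    rcases hc with rfl | rfl
    · exact add_pos_of_pos_of_nonneg hcc (sq_nonneg _)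
    · exact add_pos_of_nonneg_of_pos (sq_nonneg _) hcc
  · intro t ht
    have hYn : ‖Y t‖ ≤ 2 * ‖X‖ := by
      have h1 := norm_add_le (Y t - X) X
      rw [sub_add_cancel] at h1
      linarith [hnear t ht]
    have hb : ∀ v, ⟪Y t, v⟫_ℝ ^ 2 ≤ (2 * ‖X‖ * ‖v‖) ^ 2 := fun v =>
      sq_le_sq' (by
        have := (abs_le.mp ((abs_real_inner_le_norm (Y t) v).trans
          (mul_le_mul_of_nonneg_right hYn (norm_nonneg v)))).1
        linarith) ((real_inner_le_norm _ _).trans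
          (mul_le_mul_of_nonneg_right hYn (norm_nonneg v)))
    exact add_le_add (hb a) (hb b)

end LieStructure

theorem exists_root_re_pos (p q : ℝ) (hq : q ≠ 0) :
    ∃ z : ℂ, 0 < z.re ∧ z ^ 3 + p * z - q = 0 := by
  have hre : ∀ z : ℂ, z ^ 3 + p * z - q = 0 → z.re ≠ 0 := by
    intro z hz h
    have := congrArg Complex.re hz
    simp [pow_succ, h] at this
    exact hq this
  obtain ⟨a, ha⟩ : ∃ a : ℂ, a ^ 3 + p * a - q = 0 := by
    obtain ⟨a, ha⟩ := IsAlgClosed.exists_root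
      (Polynomial.X ^ 3 + Polynomial.C (p : ℂ) * Polynomial.X - Polynomial.C (q : ℂ)) (by
        have : (Polynomial.X ^ 3 + Polynomial.C (p : ℂ) * Polynomial.X
            - Polynomial.C (q : ℂ)).degree = 3 := by compute_degree!
        rw [this]; norm_num)
    exact ⟨a, by simpa using ha⟩
  rcases lt_or_gt_of_ne (hre a ha) with h | h
  · obtain ⟨s, hs⟩ := IsAlgClosed.exists_eq_mul_self (-3 * a ^ 2 - 4 * p)
    have h1 : ((-a + s) / 2) ^ 3 + p * ((-a + s) / 2) - q = 0 := by
      linear_combination ha + (3 * a - s) / 8 * hs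
    have h2 : ((-a - s) / 2) ^ 3 + p * ((-a - s) / 2) - q = 0 := by
      linear_combination ha + (3 * a + s) / 8 * hs
    by_cases hpos : 0 < ((-a + s) / 2).re
    · exact ⟨_, hpos, h1⟩
    · refine ⟨_, ?_, h2⟩
      simp at hpos ⊢
      linarith
  · exact ⟨a, h, ha⟩

namespace Matrix

variable {d : Matrix (Fin 3) (Fin 3) ℝ}

theorem exists_pow_three_eq_of_trace_eq_zero (htr : d.trace = 0) :
    ∃ p : ℝ, d ^ 3 = d.det • (1 : Matrix (Fin 3) (Fin 3) ℝ) - p • d := by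
  have h22 : d 2 2 = -d 0 0 - d 1 1 := by
    rw [trace_fin_three] at htr; linarith
  refine ⟨d 0 0 * d 1 1 - d 0 1 * d 1 0 + d 0 0 * d 2 2 - d 0 2 * d 2 0 + d 1 1 * d 2 2
    - d 1 2 * d 2 1, ?_⟩
  ext i j
  fin_cases i <;> fin_cases j <;>
    simp [pow_succ, mul_apply, Fin.sum_univ_three, det_fin_three, h22] <;> ring

/-- A traceless invertible real `3 × 3` matrix has a complex eigenvalue `α + iβ` with `α > 0`;
the eigenvector is `b + i a`. -/
theorem exists_eigenvalue_re_pos (htr : d.trace = 0) (hdet : d.det ≠ 0) :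
    ∃ (α β : ℝ) (a b : Fin 3 → ℝ), 0 < α ∧ (a ≠ 0 ∨ b ≠ 0) ∧
      d *ᵥ a = α • a - β • b ∧ d *ᵥ b = β • a + α • b := by
  have h22 : d 2 2 = -d 0 0 - d 1 1 := by
    rw [trace_fin_three] at htr; linarith
  obtain ⟨z, hzpos, hz⟩ := exists_root_re_pos (d 0 0 * d 1 1 - d 0 1 * d 1 0 + d 0 0 * d 2 2
    - d 0 2 * d 2 0 + d 1 1 * d 2 2 - d 1 2 * d 2 1) d.det hdet
  have hdetz : (d.map Complex.ofReal - z • (1 : Matrix (Fin 3) (Fin 3) ℂ)).det = 0 := by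
    rw [← neg_eq_zero, ← hz, det_fin_three, det_fin_three]
    simp [h22]
    ring
  obtain ⟨u, hu0, hu⟩ := exists_mulVec_eq_zero_iff.mpr hdetz
  have hu' : ∀ i, ∑ j, (d i j : ℂ) * u j = z * u i := fun i => by
    have := congrFun hu i
    rw [sub_mulVec, smul_mulVec, one_mulVec] at this
    simpa [mulVec, dotProduct, sub_eq_zero] using this
  refine ⟨z.re, z.im, fun i => (u i).re, fun i => (u i).im, hzpos, ?_, ?_, ?_⟩
  · by_contra! h
    exact hu0 (funext fun i => Complex.ext (congrFun h.1 i) (congrFun h.2 i))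
  · funext i
    simpa [mulVec, dotProduct] using congrArg Complex.re (hu' i)
  · funext i
    have := congrArg Complex.im (hu' i)
    simp [mulVec, dotProduct] at this ⊢
    linarith

end Matrix

namespace LinearMap

theorem charpoly_eq_X_pow_mul_restrict_range {K V : Type*} [Field K] [AddCommGroup V] [Module K V]
    [FiniteDimensional K V] (f : V →ₗ[K] V) :
    f.charpoly = Polynomial.X ^ (Module.finrank K V - Module.finrank K (range f)) *
      (f.rangeRestrict ∘ₗ (range f).subtype).charpoly := by
  let b := Module.finBasis K V
  let r := Module.finBasis K (range f)
  have hf : (range f).subtype ∘ₗ f.rangeRestrict = f := by ext; rfl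
  have h := Matrix.charpoly_mul_comm_of_le (toMatrix r b (range f).subtype)
    (toMatrix b r f.rangeRestrict) (by simpa using Submodule.finrank_le (range f))
  rw [← toMatrix_comp, ← toMatrix_comp, hf, charpoly_toMatrix, charpoly_toMatrix] at h
  simpa using h

/-- A traceless endomorphism `f` of rank at most two of a four-dimensional space satisfies
`f³ = μ² f` and has the eigenvalue `μ > 0`, if `σ₂(f) = -μ² < 0`. -/
theorem exists_pow_three_eq_of_charpoly_coeff_two_neg {V : Type*} [AddCommGroup V] [Module ℝ V]
    [FiniteDimensional ℝ V] (hV : Module.finrank ℝ V = 4) (f : V →ₗ[ℝ] V)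
    (htr : trace ℝ V f = 0) (hrank : Module.finrank ℝ (range f) ≤ 2)
    (hneg : f.charpoly.coeff 2 < 0) :
    ∃ μ : ℝ, 0 < μ ∧ f ^ 3 = μ ^ 2 • f ∧ f ^ 2 + μ • f ≠ 0 := by
  set h := f.rangeRestrict ∘ₗ (range f).subtype with hh
  have hcp := f.charpoly_eq_X_pow_mul_restrict_range
  rw [← hh] at hcp
  rw [hcp, Polynomial.coeff_X_pow_mul', hV] at hneg
  split_ifs at hneg with hle
  swap
  · exact absurd hneg (lt_irrefl 0)
  have hr : Module.finrank ℝ (range f) = 2 := by omega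
  rw [hr] at hneg
  have htrh : trace ℝ _ h = 0 := by
    rw [hh, trace_comp_comm', ← htr]; rfl
  have hdeg : h.charpoly.natDegree = 2 := by rw [charpoly_natDegree, hr]
  have hc1 : h.charpoly.coeff 1 = 0 := by
    let r := Module.finBasisOfFinrankEq ℝ (range f) hr
    have := Matrix.trace_eq_neg_charpoly_coeff (toMatrix r r h)
    rw [charpoly_toMatrix, ← trace_eq_matrix_trace, htrh] at this
    simpa using this
  have hc2 : h.charpoly.coeff 2 = 1 := by
    have := h.charpoly_monic.coeff_natDegree
    rwa [hdeg] at this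
  have hCH := h.aeval_self_charpoly
  simp only [Nat.sub_self, Nat.reduceSub] at hneg
  rw [Polynomial.aeval_eq_sum_range, hdeg] at hCH
  simp only [Finset.sum_range_succ, Finset.sum_range_zero, hc1, hc2, zero_smul, add_zero,
    zero_add, one_smul, pow_zero] at hCH
  set c := h.charpoly.coeff 0 with hc
  have hhh : ∀ y, h (h y) = -c • y := fun y => by
    have := LinearMap.congr_fun hCH y
    simp only [add_apply, smul_apply, Module.End.one_apply, pow_two, Module.End.mul_apply,
      zero_apply] at this
    rw [neg_smul, eq_neg_iff_add_eq_zero, add_comm]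
    exact this
  have hfh : ∀ y : range f, f y = h y := fun y => rfl
  have hsq : Real.sqrt (-c) ^ 2 = -c := Real.sq_sqrt (by linarith)
  refine ⟨Real.sqrt (-c), Real.sqrt_pos.mpr (by linarith), ?_, fun h0 => ?_⟩
  · ext y
    rw [hsq]
    have : f (f (f y)) = -c • f y := congrArg Subtype.val (hhh ⟨f y, mem_range_self f y⟩)
    simpa only [pow_succ, pow_zero, one_mul, Module.End.mul_apply, smul_apply] using this
  · have hid : h = -Real.sqrt (-c) • LinearMap.id := by
      ext ⟨_, y, rfl⟩
      have := LinearMap.congr_fun h0 y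
      simp only [add_apply, smul_apply, pow_two, Module.End.mul_apply, zero_apply] at this
      rw [← hfh]
      simpa using eq_neg_of_add_eq_zero_left this
    rw [hid, map_smul, trace_id, hr] at htrh
    have := Real.sqrt_pos.mpr (show 0 < -c by linarith)
    simp at htrh
    exact this.ne' htrh

end LinearMap

namespace LieStructure

variable {g : Type*} [NormedAddCommGroup g] [InnerProductSpace ℝ g] [FiniteDimensional ℝ g]
  (L : LieStructure g)

theorem trace_J (huni : L.IsUnimodular) (X : g) : LinearMap.trace ℝ g (L.J X) = 0 := by
  let b := stdOrthonormalBasis ℝ g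
  rw [← huni X, LinearMap.trace_eq_sum_inner _ b, LinearMap.trace_eq_sum_inner _ b]
  refine Finset.sum_congr rfl fun i _ => ?_
  rw [real_inner_comm, inner_J, L.bracket_self, inner_zero_right, add_zero]
  rfl

theorem IsStationary.inner_bracket {X : g} (hX : L.IsStationary X) (W : g) :
    ⟪X, L.bracket X W⟫_ℝ = 0 := by
  rw [← inner_adT, hX, inner_zero_left]

/-- If `Z ≠ 0` is orthogonal to `X`, commutes with `X` and lies in the kernel of `⟨X, [·,·]⟩`, then
`X` and `Z` span a plane orthogonal to the range of `J_X`. -/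
theorem finrank_range_J_le_two (hdim : Module.finrank ℝ g = 4) {X Z : g} (hX : L.IsStationary X)
    (hX0 : X ≠ 0) (hZ0 : Z ≠ 0) (hXZ : ⟪X, Z⟫_ℝ = 0) (hcomm : L.bracket X Z = 0)
    (hker : ∀ Y, ⟪X, L.bracket Y Z⟫_ℝ = 0) :
    Module.finrank ℝ (LinearMap.range (L.J X)) ≤ 2 := by
  have hli : LinearIndependent ℝ ![X, Z] := by
    refine LinearIndependent.pair_iff.mpr fun s t h => ?_
    have h1 := congrArg (fun w => ⟪X, w⟫_ℝ) h
    have h2 := congrArg (fun w => ⟪Z, w⟫_ℝ) h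
    simp only [inner_add_right, inner_smul_right, hXZ, real_inner_comm X Z, inner_zero_right,
      mul_zero, add_zero, zero_add, mul_eq_zero, inner_self_eq_zero, hX0, hZ0, or_false] at h1 h2
    exact ⟨h1, h2⟩
  have hle : Submodule.span ℝ (Set.range ![X, Z]) ≤ (LinearMap.range (L.J X))ᗮ := by
    rw [Submodule.span_le]
    rintro _ ⟨i, rfl⟩
    refine (Submodule.mem_orthogonal _ _).mpr ?_
    rintro _ ⟨Y, rfl⟩
    fin_cases i
    · have := hX.inner_bracket L Y
      simp [inner_J, L.bracket_self, L.bracket_antisymm Y X, this]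
    · simp [inner_J, hcomm, hker]
  have h1 := Submodule.finrank_mono hle
  rw [finrank_span_eq_card hli] at h1
  have h2 := (LinearMap.range (L.J X)).finrank_add_finrank_orthogonal
  simp at h1
  omega

/-- If the form `⟨X, [·,·]⟩` does not vanish, its kernel contains a nonzero vector
orthogonal to `X` and commuting with it. -/
theorem exists_commuting_of_inner_bracket_ne_zero (hdim : Module.finrank ℝ g = 4)
    (huni : L.IsUnimodular) {X : g} (hX : L.IsStationary X) (hX0 : X ≠ 0) {U V : g}
    (hUV : ⟪X, L.bracket U V⟫_ℝ ≠ 0) :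
    ∃ Z, Z ≠ 0 ∧ ⟪X, Z⟫_ℝ = 0 ∧ L.bracket X Z = 0 ∧ ∀ Y, ⟪X, L.bracket Y Z⟫_ℝ = 0 := by
  let φ : (W : g) → g →ₗ[ℝ] ℝ := fun W => (innerₛₗ ℝ X).comp (L.bracket W)
  let Φ : g →ₗ[ℝ] (Fin 3 → ℝ) := LinearMap.pi ![innerₛₗ ℝ X, φ U, φ V]
  obtain ⟨Z, hZΦ, hZ0⟩ : ∃ Z ∈ LinearMap.ker Φ, Z ≠ 0 := by
    refine Submodule.exists_mem_ne_zero_of_ne_bot (LinearMap.ker_ne_bot_of_finrank_lt ?_)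
    simp [hdim]
  have hXZ : ⟪X, Z⟫_ℝ = 0 := congrFun hZΦ 0
  have hUZ : ⟪X, L.bracket U Z⟫_ℝ = 0 := congrFun hZΦ 1
  have hVZ : ⟪X, L.bracket V Z⟫_ℝ = 0 := congrFun hZΦ 2
  have anti : ∀ a b, ⟪X, L.bracket a b⟫_ℝ = -⟪X, L.bracket b a⟫_ℝ := fun a b => by
    rw [L.bracket_antisymm, inner_neg_right]
  have hXX : ⟪X, X⟫_ℝ ≠ 0 := inner_self_ne_zero.mpr hX0
  have hXl := hX.inner_bracket L
  have hXr : ∀ W, ⟪X, L.bracket W X⟫_ℝ = 0 := fun W => by rw [anti, hXl, neg_zero]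
  have expand : ∀ c : Fin 4 → ℝ, ∑ i, c i • ![X, Z, U, V] i
      = c 0 • X + c 1 • Z + c 2 • U + c 3 • V := fun c => by
    simp [Fin.sum_univ_four]
  have hV : ∀ c : Fin 4 → ℝ, ⟪X, L.bracket (c 0 • X + c 1 • Z + c 2 • U + c 3 • V) V⟫_ℝ
      = c 2 * ⟪X, L.bracket U V⟫_ℝ := fun c => by
    simp [inner_add_right, inner_smul_right, hXl, anti Z V, hVZ, L.bracket_self]
  have hU : ∀ c : Fin 4 → ℝ, ⟪X, L.bracket U (c 0 • X + c 1 • Z + c 2 • U + c 3 • V)⟫_ℝ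
      = c 3 * ⟪X, L.bracket U V⟫_ℝ := fun c => by
    simp [inner_add_right, inner_smul_right, hXr, hUZ, L.bracket_self]
  have hli : LinearIndependent ℝ ![X, Z, U, V] := by
    rw [Fintype.linearIndependent_iff]
    intro c hc
    rw [expand] at hc
    have h2 : c 2 = 0 := by simpa [hc, hUV] using (hV c).symm
    have h3 : c 3 = 0 := by simpa [hc, hUV] using (hU c).symm
    rw [h2, h3, zero_smul, zero_smul, add_zero, add_zero] at hc
    have h0 : c 0 = 0 := by
      have := congrArg (fun w => ⟪X, w⟫_ℝ) hc
      simpa [inner_add_right, inner_smul_right, hXZ, hX0] using this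
    have h1 : c 1 = 0 := by simpa [h0, hZ0] using hc
    intro i
    fin_cases i <;> assumption
  let e := basisOfLinearIndependentOfCardEqFinrank hli (by simp [hdim])
  have he : ⇑e = ![X, Z, U, V] := coe_basisOfLinearIndependentOfCardEqFinrank _ _
  have hrepr : ∀ Y, Y = e.repr Y 0 • X + e.repr Y 1 • Z + e.repr Y 2 • U + e.repr Y 3 • V :=
    fun Y => by
      conv_lhs => rw [← e.sum_repr Y, he]
      exact expand _
  have hZ : ∀ Y, ⟪X, L.bracket Y Z⟫_ℝ = 0 := fun Y => by
    rw [hrepr Y]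
    simp [inner_add_right, inner_smul_right, hXl, hUZ, hVZ, L.bracket_self]
  have hV' : ∀ Y, ⟪X, L.bracket Y V⟫_ℝ = e.repr Y 2 * ⟪X, L.bracket U V⟫_ℝ := fun Y => by
    conv_lhs => rw [hrepr Y]
    exact hV _
  have hU' : ∀ Y, ⟪X, L.bracket U Y⟫_ℝ = e.repr Y 3 * ⟪X, L.bracket U V⟫_ℝ := fun Y => by
    conv_lhs => rw [hrepr Y]
    exact hU _
  have jac : ∀ a b, ⟪X, L.bracket (L.bracket X a) b⟫_ℝ + ⟪X, L.bracket a (L.bracket X b)⟫_ℝ = 0 :=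
    fun a b => by rw [← inner_add_right, ← L.bracket_leibniz, hXl]
  have hW2 : e.repr (L.bracket X Z) 2 = 0 := by
    have := jac Z V
    rw [hV', anti Z, hZ, neg_zero, add_zero] at this
    exact (mul_eq_zero.mp this).resolve_right hUV
  have hW3 : e.repr (L.bracket X Z) 3 = 0 := by
    have := jac U Z
    rw [hU', hZ, zero_add] at this
    exact (mul_eq_zero.mp this).resolve_right hUV
  have hW := hrepr (L.bracket X Z)
  rw [hW2, hW3, zero_smul, zero_smul, add_zero, add_zero] at hW
  have hW0 : e.repr (L.bracket X Z) 0 = 0 := by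
    have := hXl Z
    rw [hW, inner_add_right, inner_smul_right, inner_smul_right, hXZ, mul_zero, add_zero] at this
    exact (mul_eq_zero.mp this).resolve_right hXX
  have hW1 : e.repr (L.bracket X Z) 1 = 0 := by
    have htr := huni X
    rw [LinearMap.trace_eq_matrix_trace ℝ e, Matrix.trace, Fin.sum_univ_four] at htr
    simp only [Matrix.diag_apply, LinearMap.toMatrix_apply, he, ad] at htr
    simp [L.bracket_self] at htr
    have h := jac U V
    rw [hV' (L.bracket X U), hU' (L.bracket X V), ← add_mul] at h
    linarith [(mul_eq_zero.mp h).resolve_right hUV]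
  refine ⟨Z, hZ0, hXZ, ?_, hZ⟩
  rw [hW, hW0, hW1, zero_smul, zero_smul, add_zero]

end LieStructure

/-- An alternating product on a three-dimensional space with a traceless invertible derivation
vanishes. -/
theorem LinearMap.eq_zero_of_derivation_trace_eq_zero {V : Type*} [AddCommGroup V] [Module ℝ V]
    (hV : Module.finrank ℝ V = 3) (D : V →ₗ[ℝ] V) (htr : LinearMap.trace ℝ V D = 0)
    (hdet : LinearMap.det D ≠ 0) (m : V →ₗ[ℝ] V →ₗ[ℝ] V) (hm : m.IsAlt)
    (hD : ∀ u v, D (m u v) = m (D u) v + m u (D v)) : m = 0 := by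
  have : FiniteDimensional ℝ V := Module.finite_of_finrank_pos (by omega)
  let e := Module.finBasisOfFinrankEq ℝ V hV
  set d := toMatrix e e D with hd
  have hd0 : d.det ≠ 0 := by rwa [hd, det_toMatrix]
  have htrd : d.trace = 0 := by rw [← htr, trace_eq_matrix_trace ℝ e]
  have hDe : ∀ j, D (e j) = d 0 j • e 0 + d 1 j • e 1 + d 2 j • e 2 := fun j => by
    rw [← e.sum_repr (D (e j)), Fin.sum_univ_three]
    simp [hd, toMatrix_apply]
  have h10 : m (e 1) (e 0) = -m (e 0) (e 1) := by rw [hm.neg]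
  have h21 : m (e 2) (e 1) = -m (e 1) (e 2) := by rw [hm.neg]
  have h02 : m (e 0) (e 2) = -m (e 2) (e 0) := by rw [hm.neg]
  let c : Fin 3 → V := ![m (e 1) (e 2), m (e 2) (e 0), m (e 0) (e 1)]
  have hDc : ∀ j, D (c j) = -(d j 0 • c 0 + d j 1 • c 1 + d j 2 • c 2) := by
    rw [Matrix.trace_fin_three] at htrd
    have h00 : d 0 0 = -d 1 1 - d 2 2 := by linarith
    intro j
    fin_cases j <;> simp [c, hD, hDe, hm _, h10, h21, h02, h00] <;> module
  let M : Matrix (Fin 3) (Fin 3) ℝ := Matrix.of fun i j => e.repr (c j) i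
  have hM : d * M = -(M * d.transpose) := by
    ext i j
    have h := congrArg (fun v => e.repr v i) (hDc j)
    rw [← toMatrix_mulVec_repr e e] at h
    simp [Matrix.mulVec, dotProduct, Fin.sum_univ_three] at h
    simp [Matrix.mul_apply, Fin.sum_univ_three, M, hd]
    linarith
  obtain ⟨p, hp⟩ := Matrix.exists_pow_three_eq_of_trace_eq_zero htrd
  have hM3 : d ^ 3 * M = -(M * d.transpose ^ 3) := by
    have hM' : ∀ N, d * (M * N) = -(M * (d.transpose * N)) := fun N => by
      rw [← Matrix.mul_assoc, hM, Matrix.neg_mul, Matrix.mul_assoc]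
    simp only [pow_succ, pow_zero, one_mul, Matrix.mul_assoc, hM, hM', Matrix.mul_neg, neg_neg]
  rw [← Matrix.transpose_pow, hp] at hM3
  simp only [Matrix.sub_mul, Matrix.smul_mul, Matrix.one_mul, hM, Matrix.transpose_sub,
    Matrix.transpose_smul, Matrix.transpose_one, Matrix.mul_sub, Matrix.mul_smul,
    Matrix.mul_one] at hM3
  have hM0 : M = 0 := by
    have : (2 * d.det) • M = 0 := by
      ext i j
      have := congrFun₂ hM3 i j
      simp only [Matrix.sub_apply, Matrix.neg_apply, Matrix.smul_apply, Matrix.zero_apply,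
        smul_eq_mul] at this ⊢
      linarith
    exact (smul_eq_zero.mp this).resolve_left (by simpa using hd0)
  have hc : ∀ j, c j = 0 := fun j => by
    apply e.ext_elem
    intro i
    simpa [M] using congrFun (congrFun hM0 i) j
  have h0 : m (e 1) (e 2) = 0 := hc 0
  have h1 : m (e 2) (e 0) = 0 := hc 1
  have h2 : m (e 0) (e 1) = 0 := hc 2
  refine e.ext fun i => e.ext fun j => ?_
  fin_cases i <;> fin_cases j <;> simp [hm _, h10, h21, h02, h0, h1, h2]

namespace LieStructure

variable {g : Type*} [NormedAddCommGroup g] [InnerProductSpace ℝ g] [FiniteDimensional ℝ g]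
  (L : LieStructure g)

/-- If `X` is orthogonal to the derived algebra and stable, it commutes with a nonzero vector
orthogonal to it. -/
theorem exists_commuting_of_inner_bracket_eq_zero (hdim : Module.finrank ℝ g = 4)
    (huni : L.IsUnimodular) {X : g} (hX0 : X ≠ 0) (hstable : L.IsStable X)
    (hB : ∀ U V, ⟪X, L.bracket U V⟫_ℝ = 0) :
    ∃ Z, Z ≠ 0 ∧ ⟪X, Z⟫_ℝ = 0 ∧ L.bracket X Z = 0 := by
  by_contra! hinj
  set n : Submodule ℝ g := (Submodule.span ℝ {X})ᗮ with hn
  have hmem : ∀ {v}, v ∈ n ↔ ⟪X, v⟫_ℝ = 0 := Submodule.mem_orthogonal_singleton_iff_inner_right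
  have hfin : Module.finrank ℝ n = 3 := by
    have : _ + Module.finrank ℝ n = _ := (Submodule.span ℝ {X}).finrank_add_finrank_orthogonal
    rw [finrank_span_singleton hX0] at this
    omega
  have hadmem : ∀ v, L.ad X v ∈ n := fun v => hmem.mpr (hB X v)
  let D : n →ₗ[ℝ] n := (L.ad X).restrict fun v _ => hadmem v
  have htr : LinearMap.trace ℝ n D = 0 := by
    rw [← huni X]
    exact LinearMap.trace_restrict_eq_of_forall_mem n (L.ad X) hadmem
  have hdet : LinearMap.det D ≠ 0 := by
    rw [ne_eq, LinearMap.det_eq_zero_iff_ker_ne_bot, not_not, LinearMap.ker_eq_bot']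
    intro v hv
    by_contra h
    exact hinj v (by simpa using h) (hmem.mp v.2) (congrArg Subtype.val hv)
  let m : n →ₗ[ℝ] n →ₗ[ℝ] n := LinearMap.mk₂ ℝ
    (fun u v => ⟨L.bracket u v, hmem.mpr (hB u v)⟩)
    (fun _ _ _ => by ext; simp) (fun _ _ _ => by ext; simp)
    (fun _ _ _ => by ext; simp) (fun _ _ _ => by ext; simp)
  have hm0 : m = 0 := LinearMap.eq_zero_of_derivation_trace_eq_zero hfin D htr hdet m
    (fun v => Subtype.ext (L.bracket_self v)) fun u v => Subtype.ext (L.bracket_leibniz X u v)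
  let e := Module.finBasisOfFinrankEq ℝ n hfin
  obtain ⟨α, β, a, b, hα, hab, ha, hb⟩ := Matrix.exists_eigenvalue_re_pos
    (d := LinearMap.toMatrix e e D) (by rw [← htr, LinearMap.trace_eq_matrix_trace ℝ e])
    (by rwa [LinearMap.det_toMatrix])
  have hDe : ∀ w : Fin 3 → ℝ, D (e.equivFun.symm w)
      = e.equivFun.symm (Matrix.mulVec (LinearMap.toMatrix e e D) w) := fun w => by
    rw [LinearEquiv.eq_symm_apply]
    have := LinearMap.toMatrix_mulVec_repr e e D (e.equivFun.symm w)
    rw [← e.equivFun_apply, LinearEquiv.apply_symm_apply] at this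
    exact this.symm
  refine L.not_isStable_of_abelian_orthogonal hX0
    (fun u v hu hv => congrArg Subtype.val
      (LinearMap.congr_fun₂ hm0 ⟨u, hmem.mpr hu⟩ ⟨v, hmem.mpr hv⟩))
    (a := e.equivFun.symm a) (b := e.equivFun.symm b) (hmem.mp (Subtype.mem _))
    (hmem.mp (Subtype.mem _)) ?_ hα (β := β) ?_ ?_ hstable
  · simpa only [ne_eq, ZeroMemClass.coe_eq_zero, LinearEquiv.map_eq_zero_iff] using hab
  · have := congrArg Subtype.val (hDe a)
    rwa [ha, map_sub, map_smul, map_smul] at this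
  · have := congrArg Subtype.val (hDe b)
    rwa [hb, map_add, map_smul, map_smul] at this

theorem finrank_range_J_le_two_of_isStable (hdim : Module.finrank ℝ g = 4)
    (huni : L.IsUnimodular) {X : g} (hX : L.IsStationary X) (hstable : L.IsStable X) :
    Module.finrank ℝ (LinearMap.range (L.J X)) ≤ 2 := by
  by_cases hX0 : X = 0
  · have : L.J X = 0 := by
      ext Y
      refine ext_inner_right ℝ fun W => ?_
      simp [inner_J, hX0]
    rw [this, LinearMap.range_zero, finrank_bot]
    omega
  by_cases hB : ∀ U V, ⟪X, L.bracket U V⟫_ℝ = 0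
  · obtain ⟨Z, hZ0, hXZ, hcomm⟩ :=
      L.exists_commuting_of_inner_bracket_eq_zero hdim huni hX0 hstable hB
    exact L.finrank_range_J_le_two hdim hX hX0 hZ0 hXZ hcomm fun Y => hB Y Z
  · push Not at hB
    obtain ⟨U, V, hUV⟩ := hB
    obtain ⟨Z, hZ0, hXZ, hcomm, hker⟩ :=
      L.exists_commuting_of_inner_bracket_ne_zero hdim huni hX hX0 hUV
    exact L.finrank_range_J_le_two hdim hX hX0 hZ0 hXZ hcomm hker

end LieStructure

/-- Lemma 2.1 (d): in a 4-dimensional unimodular metric Lie algebra, a stable stationary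
point satisfies `rk J_X ≤ 2` and `σ₂(J_X) ≥ 0`. -/
theorem rank_le_two_and_sigma2_nonneg_of_stable    {g : Type*} [NormedAddCommGroup g] [InnerProductSpace ℝ g] [FiniteDimensional ℝ g]
    (L : LieStructure g) (hdim : Module.finrank ℝ g = 4)
    (huni : L.IsUnimodular)
    (X : g) (hX : L.IsStationary X) (hstable : L.IsStable X) :
    Module.finrank ℝ ↥(LinearMap.range (L.J X)) ≤ 2 ∧ 0 ≤ sigmaCoeff 2 (L.J X) := by
  have hrank := L.finrank_range_J_le_two_of_isStable hdim huni hX hstable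
  refine ⟨hrank, ?_⟩
  by_contra! hneg
  rw [sigmaCoeff, hdim, neg_one_sq, one_mul] at hneg
  obtain ⟨μ, hμ, hJ, hne⟩ := LinearMap.exists_pow_three_eq_of_charpoly_coeff_two_neg hdim (L.J X)
    (L.trace_J huni X) hrank hneg
  exact L.not_isStable_of_J_pow_three hX hμ hJ hne hstable
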